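/- There is an absolute constant c > 0 such that for every n divisible by 4 and every τ ≥ 1, there exist ε > 0 and a set X of n entities with piecewise-linear trajectories of τ edges each such that, for parameters m = 1 and δ = 0, the sum of |G| over all distinct maximal groups (G, I_G) is at least c·τ·n⁴. -/

import Mathlib

open Set

/-- The plane with the Euclidean metric. -/
abbrev Plane : Type := EuclideanSpace ℝ (Fin 2)

/-- `f` is a piecewise-linear trajectory with breakpoints `t 0, …, t τ`:
it is (the restriction of) an affine map on each interval `[t i, t (i+1)]`. -/
def IsPLTrajectory (τ : ℕ) (t : Fin (τ + 1) → ℝ) (f : ℝ → Plane) : Prop :=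
  ∀ i : Fin τ, ∃ g : ℝ →ᵃ[ℝ] Plane,
    ∀ s ∈ Icc (t i.castSucc) (t i.succ), f s = g s

/-- Entities `x` and `y` are directly connected at time `s`: their `ε`-discs overlap. -/
def DirectlyConnected {n : ℕ} (p : Fin n → ℝ → Plane) (ε s : ℝ) (x y : Fin n) : Prop :=
  dist (p x s) (p y s) ≤ 2 * ε

/-- Entities `x` and `y` are `ε`-connected at time `s`: there is a sequence
`x = x_0, …, x_k = y` of entities with consecutive ones directly connected at `s`. -/
def EpsConnected {n : ℕ} (p : Fin n → ℝ → Plane) (ε s : ℝ) : Fin n → Fin n → Prop :=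
  Relation.ReflTransGen (DirectlyConnected p ε s)

/-- A component at time `s` is a maximal set of pairwise `ε`-connected entities. -/
def IsComponent {n : ℕ} (p : Fin n → ℝ → Plane) (ε s : ℝ) (C : Set (Fin n)) : Prop :=
  (∀ x ∈ C, ∀ y ∈ C, EpsConnected p ε s x y) ∧
  (∀ D : Set (Fin n), C ⊆ D → (∀ x ∈ D, ∀ y ∈ D, EpsConnected p ε s x y) → D = C)
/-- `G` is a group on the interval `[a, b] ⊆ [t0, tτ]` for parameters `ε`, `m`, `δ`:
it has at least `m` entities, the interval has length at least `δ`, and at every time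
`s ∈ [a, b]` all of `G` lies in a single component. -/
def IsGroup {n : ℕ} (p : Fin n → ℝ → Plane) (ε : ℝ) (m : ℕ) (δ t0 tτ : ℝ)
    (G : Finset (Fin n)) (a b : ℝ) : Prop :=
  m ≤ G.card ∧ t0 ≤ a ∧ a ≤ b ∧ b ≤ tτ ∧ δ ≤ b - a ∧
  ∀ s ∈ Icc a b, ∃ C : Set (Fin n), IsComponent p ε s C ∧ ↑G ⊆ C

/-- `G` is a maximal group on `[a, b]`: it is a group on `[a, b]`, and the only group
`(H, [c, d])` covering `(G, [a, b])` (i.e. with `G ⊆ H` and `[a, b] ⊆ [c, d]`) is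
`(G, [a, b])` itself. -/
def IsMaximalGroup {n : ℕ} (p : Fin n → ℝ → Plane) (ε : ℝ) (m : ℕ) (δ t0 tτ : ℝ)
    (G : Finset (Fin n)) (a b : ℝ) : Prop :=
  IsGroup p ε m δ t0 tτ G a b ∧
  ∀ (H : Finset (Fin n)) (c d : ℝ), IsGroup p ε m δ t0 tτ H c d →
    G ⊆ H → c ≤ a → b ≤ d → H = G ∧ c = a ∧ d = b


lemma eps_symm {n : ℕ} {p : Fin n → ℝ → Plane} {ε s : ℝ} {x y : Fin n}
    (h : EpsConnected p ε s x y) : EpsConnected p ε s y x := by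
  unfold EpsConnected at *
  induction h with
  | refl => exact Relation.ReflTransGen.refl
  | tail h1 h2 ih =>
    refine Relation.ReflTransGen.head ?_ ih
    unfold DirectlyConnected at *
    rwa [dist_comm]

lemma comp_exists {n : ℕ} (p : Fin n → ℝ → Plane) (ε s : ℝ) (r : Fin n) :
    IsComponent p ε s {z | EpsConnected p ε s r z} := by
  refine ⟨fun x hx y hy => Relation.ReflTransGen.trans (eps_symm hx) hy, ?_⟩
  intro D hD h
  apply Set.Subset.antisymm _ hD
  intro z hz
  exact h r (hD Relation.ReflTransGen.refl) z hz

lemma max_of {n : ℕ} (p : Fin n → ℝ → Plane) (ε t0 t1 a b : ℝ) (G : Finset (Fin n)) (r : Fin n)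
    (hG : ∀ z, z ∈ G ↔ ∀ s ∈ Icc a b, EpsConnected p ε s r z)
    (h0 : t0 ≤ a) (hab : a ≤ b) (h1 : b ≤ t1)
    (hl : ∀ c < a, ∃ s, c ≤ s ∧ s ≤ a ∧ ∃ x ∈ G, ∃ y ∈ G, ¬ EpsConnected p ε s x y)
    (hr : ∀ d > b, ∃ s, b ≤ s ∧ s ≤ d ∧ ∃ x ∈ G, ∃ y ∈ G, ¬ EpsConnected p ε s x y) :
    IsMaximalGroup p ε 1 0 t0 t1 G a b := by
  have hrG : r ∈ G := (hG r).2 fun s _ => Relation.ReflTransGen.refl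
  refine ⟨⟨Finset.card_pos.2 ⟨r, hrG⟩, h0, hab, h1, by linarith, fun s hs =>
    ⟨_, comp_exists p ε s r, fun z hz => (hG z).1 hz s hs⟩⟩, ?_⟩
  rintro H c d ⟨-, -, hcd, -, -, hH⟩ hGH hca hbd
  have key : ∀ s ∈ Icc c d, ∀ x ∈ H, ∀ y ∈ H, EpsConnected p ε s x y := by
    intro s hs x hx y hy
    obtain ⟨C, hC, hHC⟩ := hH s hs
    exact hC.1 x (hHC hx) y (hHC hy)
  refine ⟨?_, ?_, ?_⟩
  · apply Finset.Subset.antisymm _ hGH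
    intro z hz
    exact (hG z).2 fun s hs => key s ⟨hca.trans hs.1, hs.2.trans hbd⟩ r (hGH hrG) z hz
  · by_contra hne
    obtain ⟨s, h1, h2, x, hx, y, hy, hxy⟩ := hl c (lt_of_le_of_ne hca hne)
    exact hxy (key s ⟨h1, by linarith⟩ x (hGH hx) y (hGH hy))
  · by_contra hne
    obtain ⟨s, h1, h2, x, hx, y, hy, hxy⟩ := hr d (lt_of_le_of_ne hbd (Ne.symm hne))
    exact hxy (key s ⟨by linarith, h2⟩ x (hGH hx) y (hGH hy))

/-- triangle wave -/
noncomputable def phi (T t : ℝ) : ℝ :=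
  min (2 * T * Int.fract (t / (2 * T))) (2 * T - 2 * T * Int.fract (t / (2 * T)))

lemma phi_even {T t : ℝ} (hT : 0 < T) (q : ℕ) (h1 : 2 * q * T ≤ t) (h2 : t ≤ (2 * q + 1) * T) :
    phi T t = t - 2 * q * T := by
  have hf : Int.fract (t / (2 * T)) = t / (2 * T) - q := by
    rw [Int.fract_eq_iff]
    refine ⟨?_, ?_, q, by simp⟩
    · rw [sub_nonneg, le_div_iff₀ (by positivity)]; linarith
    · rw [sub_lt_iff_lt_add, div_lt_iff₀ (by positivity)]; linarith
  have : 2 * T * (t / (2 * T) - q) = t - 2 * q * T := by field_simp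
  unfold phi
  rw [hf, this, min_eq_left]
  linarith

lemma phi_odd {T t : ℝ} (hT : 0 < T) (q : ℕ) (h1 : (2 * q + 1) * T ≤ t)
    (h2 : t ≤ (2 * q + 2) * T) :
    phi T t = (2 * q + 2) * T - t := by
  rcases h2.eq_or_lt with h | h
  · rw [phi_even hT (q + 1)]
    · push_cast; linarith
    · push_cast; linarith
    · push_cast; linarith
  have hf : Int.fract (t / (2 * T)) = t / (2 * T) - q := by
    rw [Int.fract_eq_iff]
    refine ⟨?_, ?_, q, by simp⟩
    · rw [sub_nonneg, le_div_iff₀ (by positivity)]; linarith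
    · rw [sub_lt_iff_lt_add, div_lt_iff₀ (by positivity)]; linarith
  have : 2 * T * (t / (2 * T) - q) = t - 2 * q * T := by field_simp
  unfold phi
  rw [hf, this, min_eq_right] <;> linarith

/-- position on the line, as a function of the shift -/
noncomputable def pos (m z : ℕ) (s : ℝ) : ℝ :=
  if z < 2 * m then s + z * (m + 3) else ((z : ℝ) - 2 * m) * (m + 4)

/-- the period -/
def per (m : ℕ) : ℕ := (m + 1) * (m + 4)

/-- the trajectories -/
noncomputable def traj (m : ℕ) (z : Fin (4 * m)) (t : ℝ) : Plane :=
  EuclideanSpace.single 0 (pos m z (phi (per m) t))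

lemma per_pos (m : ℕ) : (0 : ℝ) < per m := by
  unfold per; positivity

lemma direct_iff (m : ℕ) (t : ℝ) (x y : Fin (4 * m)) :
    DirectlyConnected (traj m) ((m + 2) / 2) t x y ↔
      |pos m x (phi (per m) t) - pos m y (phi (per m) t)| ≤ m + 2 := by
  unfold DirectlyConnected traj
  rw [EuclideanSpace.dist_single_same, Real.dist_eq]
  rw [mul_div_cancel₀ _ (by norm_num : (2 : ℝ) ≠ 0)]

lemma affine_ex (α β : ℝ) : ∃ g : ℝ →ᵃ[ℝ] Plane, ∀ s, g s =
    EuclideanSpace.single 0 (α * s + β) := by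
  refine ⟨AffineMap.lineMap (EuclideanSpace.single 0 β) (EuclideanSpace.single 0 (α + β)), ?_⟩
  intro s
  ext i
  fin_cases i
  · simp [AffineMap.lineMap_apply]; ring
  · simp [AffineMap.lineMap_apply]

lemma traj_pl (m τ : ℕ) (z : Fin (4 * m)) :
    IsPLTrajectory τ (fun r => (r : ℕ) * (per m : ℝ)) (traj m z) := by
  intro r
  have hT := per_pos m
  have hphi : ∃ α β : ℝ, ∀ s ∈ Icc (((r.castSucc : Fin (τ + 1)) : ℕ) * (per m : ℝ))
      (((r.succ : Fin (τ + 1)) : ℕ) * (per m : ℝ)), phi (per m) s = α * s + β := by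
    simp only [Fin.val_castSucc, Fin.val_succ]
    rcases Nat.even_or_odd' (r : ℕ) with ⟨q, hq | hq⟩
    · refine ⟨1, - (2 * q * per m), fun s hs => ?_⟩
      rw [hq] at hs
      have h1 := hs.1
      have h2 := hs.2
      push_cast at h1 h2
      rw [phi_even hT q h1 h2]; ring
    · refine ⟨-1, (2 * q + 2) * per m, fun s hs => ?_⟩
      rw [hq] at hs
      have h1 := hs.1
      have h2 := hs.2
      push_cast at h1 h2
      rw [phi_odd hT q h1 (by linarith)]; ring
  obtain ⟨α, β, h⟩ := hphi
  by_cases hz : (z : ℕ) < 2 * m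
  · obtain ⟨g, hg⟩ := affine_ex α (β + z * (m + 3))
    refine ⟨g, fun s hs => ?_⟩
    rw [hg, traj, h s hs, pos, if_pos hz, add_assoc]
  · obtain ⟨g, hg⟩ := affine_ex 0 (((z : ℕ) - 2 * m) * (m + 4))
    refine ⟨g, fun s hs => ?_⟩
    rw [hg, traj, h s hs, pos, if_neg hz, zero_mul, zero_add]

lemma cut {m : ℕ} {t : ℝ} {x y : Fin (4 * m)}
    (hxy : pos m x (phi (per m) t) + (m + 2) < pos m y (phi (per m) t))
    (hz : ∀ z : Fin (4 * m), pos m z (phi (per m) t) ≤ pos m x (phi (per m) t) ∨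
      pos m y (phi (per m) t) ≤ pos m z (phi (per m) t)) :
    ¬ EpsConnected (traj m) ((m + 2) / 2) t x y := by
  intro h
  have hm : (0 : ℝ) ≤ m := by positivity
  have key : ∀ z, EpsConnected (traj m) ((m + 2) / 2) t x z →
      pos m z (phi (per m) t) ≤ pos m x (phi (per m) t) := by
    intro z h
    unfold EpsConnected at h
    induction h with
    | refl => exact le_rfl
    | @tail b c h1 h2 ih =>
      rw [direct_iff] at h2
      have := (abs_le.1 h2).1
      rcases hz c with h | h
      · exact h
      · linarith
  have := key y h
  linarith

lemma pos_x {m z : ℕ} (s : ℝ) (h : z < 2 * m) : pos m z s = s + z * (m + 3) := if_pos h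

lemma pos_y (m w : ℕ) (s : ℝ) : pos m (2 * m + w) s = w * (m + 4) := by
  unfold pos
  rw [if_neg (by omega)]
  push_cast
  ring

lemma xy_cases {m : ℕ} (z : Fin (4 * m)) : (z : ℕ) < 2 * m ∨ ∃ w : ℕ, (z : ℕ) = 2 * m + w := by
  by_cases h : (z : ℕ) < 2 * m
  · exact Or.inl h
  · exact Or.inr ⟨z - 2 * m, by omega⟩

lemma cut_left {m i k : ℕ} {t ρ : ℝ} (hi : i < m) (hk : k < m)
    (hφ : phi (per m) t = k * (m + 4) + ρ) (h1 : i + 1 ≤ ρ) (h2 : ρ < i + 2) :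
    ¬ EpsConnected (traj m) ((m + 2) / 2) t ⟨i, by omega⟩ ⟨2 * m + (i + k + 1), by omega⟩ := by
  have hm : (0 : ℝ) ≤ m := by positivity
  apply cut
  · simp only [pos_y, hφ, pos_x (m := m) (z := i) _ (by omega)]
    push_cast
    linarith
  · intro z
    simp only [pos_y, hφ, pos_x (m := m) (z := i) _ (by omega)]
    push_cast
    rcases xy_cases z with hz | ⟨w, hw⟩
    · rw [pos_x _ hz]
      rcases Nat.lt_or_ge i z with h | h
      · right
        have h' : (i : ℝ) + 1 ≤ (z : ℕ) := by exact_mod_cast h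
        have := mul_le_mul_of_nonneg_right h' (by positivity : (0 : ℝ) ≤ m + 3)
        linarith
      · left
        have h' : ((z : ℕ) : ℝ) ≤ i := by exact_mod_cast h
        have := mul_le_mul_of_nonneg_right h' (by positivity : (0 : ℝ) ≤ m + 3)
        linarith
    · rw [hw, pos_y]
      rcases Nat.lt_or_ge (i + k) w with h | h
      · right
        have h' : (i : ℝ) + k + 1 ≤ w := by exact_mod_cast h
        exact mul_le_mul_of_nonneg_right h' (by positivity : (0 : ℝ) ≤ m + 4)
      · left
        have h' : (w : ℝ) ≤ i + k := by exact_mod_cast h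
        have := mul_le_mul_of_nonneg_right h' (by positivity : (0 : ℝ) ≤ m + 4)
        linarith

lemma cut_right {m j k : ℕ} {t ρ : ℝ} (hj : j < m) (hk : k < m)
    (hφ : phi (per m) t = k * (m + 4) + ρ) (h1 : j + m + 2 < ρ) (h2 : ρ ≤ j + m + 3) :
    ¬ EpsConnected (traj m) ((m + 2) / 2) t ⟨2 * m + (j + k), by omega⟩ ⟨j, by omega⟩ := by
  have hm : (0 : ℝ) ≤ m := by positivity
  apply cut
  · simp only [pos_y, hφ, pos_x (m := m) (z := j) _ (by omega)]
    push_cast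
    linarith
  · intro z
    simp only [pos_y, hφ, pos_x (m := m) (z := j) _ (by omega)]
    push_cast
    rcases xy_cases z with hz | ⟨w, hw⟩
    · rw [pos_x _ hz]
      rcases Nat.lt_or_ge z j with h | h
      · left
        have h' : ((z : ℕ) : ℝ) + 1 ≤ j := by exact_mod_cast h
        have := mul_le_mul_of_nonneg_right h' (by positivity : (0 : ℝ) ≤ m + 3)
        linarith
      · right
        have h' : (j : ℝ) ≤ (z : ℕ) := by exact_mod_cast h
        have := mul_le_mul_of_nonneg_right h' (by positivity : (0 : ℝ) ≤ m + 3)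
        linarith
    · rw [hw, pos_y]
      rcases Nat.lt_or_ge (j + k) w with h | h
      · right
        have h' : (j : ℝ) + k + 1 ≤ w := by exact_mod_cast h
        have := mul_le_mul_of_nonneg_right h' (by positivity : (0 : ℝ) ≤ m + 4)
        linarith
      · left
        have h' : (w : ℝ) ≤ j + k := by exact_mod_cast h
        exact mul_le_mul_of_nonneg_right h' (by positivity : (0 : ℝ) ≤ m + 4)

lemma conn_xy0 {m l k : ℕ} {t ρ : ℝ} (hl : l < m) (hk : k < m)
    (hφ : phi (per m) t = k * (m + 4) + ρ) (h1 : l + 2 ≤ ρ) (h2 : ρ ≤ l + m + 2) :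
    EpsConnected (traj m) ((m + 2) / 2) t ⟨l, by omega⟩ ⟨2 * m + (l + k), by omega⟩ := by
  apply Relation.ReflTransGen.single
  rw [direct_iff, pos_y, pos_x _ (by simp; omega), hφ, abs_le]
  push_cast
  constructor <;> linarith

lemma conn_xy1 {m l k : ℕ} {t ρ : ℝ} (hl : l < m) (hk : k < m)
    (hφ : phi (per m) t = k * (m + 4) + ρ) (h1 : l + 2 ≤ ρ) (h2 : ρ ≤ l + m + 2) :
    EpsConnected (traj m) ((m + 2) / 2) t ⟨l, by omega⟩ ⟨2 * m + (l + k + 1), by omega⟩ := by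
  apply Relation.ReflTransGen.single
  rw [direct_iff, pos_y, pos_x _ (by simp; omega), hφ, abs_le]
  push_cast
  constructor <;> linarith

lemma conn_xx {m i j k : ℕ} {t ρ : ℝ} (hi : i < m) (hk : k < m)
    (hφ : phi (per m) t = k * (m + 4) + ρ) (h1 : i + 2 ≤ ρ) (h2 : ρ ≤ j + m + 2)
    (l : ℕ) (hjl : j ≤ l) (hli : l ≤ i) :
    EpsConnected (traj m) ((m + 2) / 2) t ⟨j, by omega⟩ ⟨l, by omega⟩ := by
  induction l, hjl using Nat.le_induction with
  | base => exact Relation.ReflTransGen.refl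
  | succ l hjl ih =>
    have e1 : (j : ℝ) ≤ l := by exact_mod_cast hjl
    have e2 : (l : ℝ) + 1 ≤ i := by exact_mod_cast hli
    have a1 := conn_xy1 (l := l) (by omega) hk hφ (by linarith) (by linarith)
    have a2 := conn_xy0 (l := l + 1) (by omega) hk hφ (by push_cast; linarith)
      (by push_cast; linarith)
    have e : l + 1 + k = l + k + 1 := by omega
    simp only [e] at a2
    exact (ih (by omega)).trans (a1.trans (eps_symm a2))

/-- start time -/
def sta (m q k i : ℕ) : ℕ := 2 * per m * q + (k * (m + 4) + (i + 2))

/-- end time -/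
def fin' (m q k j : ℕ) : ℕ := 2 * per m * q + (k * (m + 4) + (j + (m + 2)))

open Classical in
/-- the group -/
noncomputable def grp (m : ℕ) (a b : ℝ) (r : ℕ) : Finset (Fin (4 * m)) :=
  Finset.univ.filter fun z => ∃ h : r < 4 * m, ∀ s ∈ Icc a b,
    EpsConnected (traj m) ((m + 2) / 2) s ⟨r, h⟩ z

lemma grp_main {m τ q k i j : ℕ} (hq : 2 * q + 1 ≤ τ) (hk : k < m) (hi : i < m) (hj : j ≤ i) :
    IsMaximalGroup (traj m) ((m + 2) / 2) 1 0 0 (τ * per m)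
      (grp m (sta m q k i) (fin' m q k j) j) (sta m q k i) (fin' m q k j) ∧
    i + 1 - j ≤ (grp m (sta m q k i) (fin' m q k j) j).card := by
  have hT := per_pos m
  have hsta : (sta m q k i : ℝ) = 2 * q * per m + (k * (m + 4) + (i + 2)) := by
    unfold sta; push_cast; ring
  have hfin : (fin' m q k j : ℝ) = 2 * q * per m + (k * (m + 4) + (j + (m + 2))) := by
    unfold fin'; push_cast; ring
  have hper : ((per m : ℕ) : ℝ) = (m + 1) * (m + 4) := by unfold per; push_cast; ring
  have hk' : (k : ℝ) + 1 ≤ m := by exact_mod_cast hk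
  have hi' : (i : ℝ) + 1 ≤ m := by exact_mod_cast hi
  have hj' : (j : ℝ) ≤ i := by exact_mod_cast hj
  have hj0 : (0 : ℝ) ≤ j := by positivity
  have hk0 : (0 : ℝ) ≤ k * (m + 4) := by positivity
  have hkm := mul_le_mul_of_nonneg_right hk' (by positivity : (0 : ℝ) ≤ m + 4)
  have hq' : (2 * q + 1 : ℝ) ≤ τ := by exact_mod_cast hq
  have hqT := mul_le_mul_of_nonneg_right hq' hT.le
  have hq0 : (0 : ℝ) ≤ 2 * q * per m := by positivity
  generalize hA : (sta m q k i : ℝ) = a at *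
  generalize hB : (fin' m q k j : ℝ) = b at *
  have hφ : ∀ t, a - 1 ≤ t → t ≤ b + 1 →
      phi (per m) t = k * (m + 4) + (t - 2 * q * per m - k * (m + 4)) := by
    intro t h1 h2
    rw [phi_even hT q (by linarith) (by linarith)]
    ring
  have hmem : ∀ z, z ∈ grp m a b j ↔ ∀ s ∈ Icc a b,
      EpsConnected (traj m) ((m + 2) / 2) s ⟨j, by omega⟩ z := by
    intro z
    simp only [grp, Finset.mem_filter, Finset.mem_univ, true_and]
    exact ⟨fun ⟨_, h⟩ => h, fun h => ⟨by omega, h⟩⟩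
  have hx : ∀ l (h1 : j ≤ l) (h2 : l ≤ i), (⟨l, by omega⟩ : Fin (4 * m)) ∈ grp m a b j := by
    intro l h1 h2
    rw [hmem]
    intro s hs
    exact conn_xx hi hk (hφ s (by linarith [hs.1]) (by linarith [hs.2]))
      (by linarith [hs.1]) (by linarith [hs.2]) l h1 h2
  have hy0 : (⟨2 * m + (j + k), by omega⟩ : Fin (4 * m)) ∈ grp m a b j := by
    rw [hmem]
    intro s hs
    exact conn_xy0 (by omega) hk (hφ s (by linarith [hs.1]) (by linarith [hs.2]))
      (by linarith [hs.1]) (by linarith [hs.2])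
  have hy1 : (⟨2 * m + (i + k + 1), by omega⟩ : Fin (4 * m)) ∈ grp m a b j := by
    rw [hmem]
    intro s hs
    refine ((hmem _).1 (hx i hj le_rfl) s hs).trans ?_
    exact conn_xy1 (by omega) hk (hφ s (by linarith [hs.1]) (by linarith [hs.2]))
      (by linarith [hs.1]) (by linarith [hs.2])
  refine ⟨max_of _ _ _ _ _ _ _ _ hmem (by linarith) (by linarith) (by linarith) ?_ ?_, ?_⟩
  · intro c hc
    have h1 : max c (a - 1) < a := max_lt hc (by linarith)
    have h2 := le_max_right c (a - 1)
    refine ⟨max c (a - 1), le_max_left _ _, h1.le, _, hx i hj le_rfl, _, hy1, ?_⟩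
    exact cut_left hi hk (hφ _ h2 (by linarith)) (by linarith) (by linarith)
  · intro d hd
    have h1 : b < min d (b + 1) := lt_min hd (by linarith)
    have h2 := min_le_right d (b + 1)
    refine ⟨min d (b + 1), h1.le, min_le_left _ _, _, hy0, _, hx j le_rfl hj, ?_⟩
    exact cut_right (by omega) hk (hφ _ (by linarith) h2) (by linarith) (by linarith)
  · have : (Finset.Icc j i).card = i + 1 - j := by simp
    rw [← this]
    apply Finset.card_le_card_of_injOn (fun l => if h : l < 4 * m then ⟨l, h⟩ else ⟨0, by omega⟩)
    · intro l hl
      have hl := Finset.mem_Icc.1 hl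
      have : l < 4 * m := by omega
      simp only [this, dite_true]
      exact hx l hl.1 hl.2
    · intro l hl l' hl' h
      have hl := Finset.mem_Icc.1 hl
      have hl' := Finset.mem_Icc.1 hl'
      have h1 : l < 4 * m := by omega
      have h2 : l' < 4 * m := by omega
      simpa [h1, h2] using h

/-- index set -/
def idx (m τ : ℕ) : Finset (ℕ × ℕ × (Σ _ : ℕ, ℕ)) :=
  Finset.range ((τ + 1) / 2) ×ˢ Finset.range m ×ˢ
    ((Finset.range m).sigma fun i => Finset.range (i + 1))

/-- the indexing -/
noncomputable def fam (m : ℕ) (u : ℕ × ℕ × (Σ _ : ℕ, ℕ)) : Finset (Fin (4 * m)) × ℝ × ℝ :=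
  (grp m (sta m u.1 u.2.1 u.2.2.1) (fin' m u.1 u.2.1 (u.2.2.1 - u.2.2.2)) (u.2.2.1 - u.2.2.2),
    sta m u.1 u.2.1 u.2.2.1, fin' m u.1 u.2.1 (u.2.2.1 - u.2.2.2))

lemma divmod_inj {D a b r s : ℕ} (hr : r < D) (hs : s < D) (h : D * a + r = D * b + s) :
    a = b ∧ r = s := by
  have h1 : (D * a + r) / D = a := by
    rw [Nat.mul_add_div (by omega), Nat.div_eq_of_lt hr, add_zero]
  have h2 : (D * b + s) / D = b := by
    rw [Nat.mul_add_div (by omega), Nat.div_eq_of_lt hs, add_zero]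
  have : a = b := by rw [← h1, ← h2, h]
  subst this
  exact ⟨rfl, by omega⟩

lemma fam_inj (m τ : ℕ) : Set.InjOn (fam m) (idx m τ) := by
  rintro ⟨q, k, i, l⟩ h ⟨q', k', i', l'⟩ h' he
  simp only [idx, Finset.coe_product, Finset.mem_coe, Finset.mem_product, Finset.mem_sigma,
    Finset.mem_range, Set.mem_prod] at h h'
  obtain ⟨-, hk, hi, hl⟩ := h
  obtain ⟨-, hk', hi', hl'⟩ := h'
  simp only [fam, Prod.mk.injEq, Nat.cast_inj] at he
  obtain ⟨-, e1, e2⟩ := he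
  have bd : ∀ k i, k < m → i < m → k * (m + 4) + (i + 2) < 2 * per m := by
    intro k i hk hi
    have : (k + 1) * (m + 4) ≤ m * (m + 4) := Nat.mul_le_mul_right _ hk
    unfold per
    nlinarith
  unfold sta at e1
  obtain ⟨rfl, e3⟩ := divmod_inj (bd k i hk hi) (bd k' i' hk' hi') e1
  rw [mul_comm k, mul_comm k'] at e3
  obtain ⟨rfl, e4⟩ := divmod_inj (by omega) (by omega) e3
  unfold fin' at e2
  have : i = i' := by omega
  subst this
  have : l = l' := by omega
  subst this
  rfl

lemma sum1 (m : ℕ) : (m : ℝ) ^ 2 / 2 ≤ ∑ l ∈ Finset.range m, ((l : ℝ) + 1) := by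
  induction m with
  | zero => simp
  | succ m ih => rw [Finset.sum_range_succ]; push_cast; nlinarith

lemma sum2 (m : ℕ) : (m : ℝ) ^ 3 / 6 ≤
    ∑ i ∈ Finset.range m, ∑ l ∈ Finset.range (i + 1), ((l : ℝ) + 1) := by
  induction m with
  | zero => simp
  | succ m ih =>
    rw [Finset.sum_range_succ]
    have := sum1 (m + 1)
    push_cast at *
    have : (0 : ℝ) ≤ m := by positivity
    nlinarith

/-- There is an absolute constant `c > 0` such that for every `n` divisible by `4` and
every `τ ≥ 1` there exist `ε > 0` and `n` entities with piecewise-linear trajectories of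
`τ` edges such that, for parameters `m = 1` and `δ = 0`, the sum of `|G|` over all
distinct maximal groups `(G, I_G)` is at least `c · τ · n⁴`. -/
theorem stmt_12 :
    ∃ c : ℝ, 0 < c ∧ ∀ n τ : ℕ, 4 ∣ n → 1 ≤ τ →
      ∃ (ε : ℝ) (_ : 0 < ε) (t : Fin (τ + 1) → ℝ) (_ : StrictMono t)
        (p : Fin n → ℝ → Plane) (_ : ∀ x, IsPLTrajectory τ t (p x))
        (S : Finset (Finset (Fin n) × ℝ × ℝ)),
        (∀ g ∈ S, IsMaximalGroup p ε 1 0 (t 0) (t (Fin.last τ)) g.1 g.2.1 g.2.2) ∧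
        c * τ * n ^ 4 ≤ ∑ g ∈ S, (g.1.card : ℝ) := by
  refine ⟨1 / 3072, by norm_num, ?_⟩
  rintro n τ ⟨m, rfl⟩ hτ
  refine ⟨(m + 2) / 2, by positivity, fun r => (r : ℕ) * (per m : ℝ), ?_, traj m,
    traj_pl m τ, (idx m τ).image (fam m), ?_, ?_⟩
  · intro r r' h
    have h' : ((r : ℕ) : ℝ) < (r' : ℕ) := by exact_mod_cast h
    exact mul_lt_mul_of_pos_right h' (per_pos m)
  · intro g hg
    obtain ⟨⟨q, k, i, l⟩, hu, rfl⟩ := Finset.mem_image.1 hg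
    simp only [idx, Finset.mem_product, Finset.mem_sigma, Finset.mem_range] at hu
    have := (grp_main (m := m) (τ := τ) (q := q) (k := k) (i := i) (j := i - l) (by omega)
      hu.2.1 hu.2.2.1 (by omega)).1
    simpa [fam] using this
  · rw [Finset.sum_image (fam_inj m τ)]
    have h1 : ∑ u ∈ idx m τ, ((u.2.2.2 : ℝ) + 1) ≤ ∑ u ∈ idx m τ, ((fam m u).1.card : ℝ) := by
      apply Finset.sum_le_sum
      rintro ⟨q, k, i, l⟩ hu
      simp only [idx, Finset.mem_product, Finset.mem_sigma, Finset.mem_range] at hu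
      have := (grp_main (m := m) (τ := τ) (q := q) (k := k) (i := i) (j := i - l) (by omega)
        hu.2.1 hu.2.2.1 (by omega)).2
      have h2 : l + 1 ≤ (fam m (q, k, ⟨i, l⟩)).1.card := by
        refine le_trans ?_ this
        omega
      exact_mod_cast h2
    refine le_trans ?_ h1
    unfold idx
    rw [Finset.sum_product]
    simp only [Finset.sum_product, Finset.sum_sigma, Finset.sum_const, Finset.card_range,
      nsmul_eq_mul]
    have h3 := sum2 m
    have h4 : (τ : ℝ) / 2 ≤ ((τ + 1) / 2 : ℕ) := by
      rw [div_le_iff₀ (by norm_num)]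
      have : τ ≤ (τ + 1) / 2 * 2 := by omega
      exact_mod_cast this
    calc (1 / 3072 : ℝ) * τ * ((4 * m : ℕ) : ℝ) ^ 4 = τ / 2 * (m * ((m : ℝ) ^ 3 / 6)) := by
          push_cast; ring
      _ ≤ _ := by gcongr
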